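/- Let s ∈ (0,1), a ∈ ℝⁿ, b ∈ ℝ, and define φ(x) = ((x_n)_+)^s (a·x + b). Then for every h ∈ ℝⁿ with h_n ≥ 0 and every operator L in the class L_*(s), one has L(φ(·+h) − φ)(x) = 0 for all x with x_n > 0. In particular M⁺{φ(·+h)−φ} = M⁻{φ(·+h)−φ} = 0 in {x_n > 0}. -/

import Mathlib

open MeasureTheory
open scoped RealInnerProductSpace

/-- Spectral measures of the class `L_*`: measurable, even, `lam ≤ μ ≤ Lam` on the sphere. -/
def SpecOK (n : ℕ) (lam Lam : ℝ) (μ : EuclideanSpace ℝ (Fin n) → ℝ) : Prop :=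
  Measurable μ ∧ ∀ θ : EuclideanSpace ℝ (Fin n), ‖θ‖ = 1 →
    μ (-θ) = μ θ ∧ lam ≤ μ θ ∧ μ θ ≤ Lam

/-- The operator of the class `L_*(s)` with spectral measure `μ`. -/
noncomputable def kerOp (n : ℕ) (s : ℝ) (μ u : EuclideanSpace ℝ (Fin n) → ℝ)
    (x : EuclideanSpace ℝ (Fin n)) : ℝ :=
  (1 - s) * ∫ y : EuclideanSpace ℝ (Fin n),
    ((u (x + y) + u (x - y)) / 2 - u x) * μ (‖y‖⁻¹ • y) / ‖y‖ ^ ((n : ℝ) + 2 * s)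

/-- Extremal operator `M⁺` of the class `L_*(s)`. -/
noncomputable def Mplus (n : ℕ) (s lam Lam : ℝ) (u : EuclideanSpace ℝ (Fin n) → ℝ)
    (x : EuclideanSpace ℝ (Fin n)) : ℝ :=
  sSup {z : ℝ | ∃ μ, SpecOK n lam Lam μ ∧ z = kerOp n s μ u x}

/-- Extremal operator `M⁻` of the class `L_*(s)`. -/
noncomputable def Mminus (n : ℕ) (s lam Lam : ℝ) (u : EuclideanSpace ℝ (Fin n) → ℝ)
    (x : EuclideanSpace ℝ (Fin n)) : ℝ :=
  sInf {z : ℝ | ∃ μ, SpecOK n lam Lam μ ∧ z = kerOp n s μ u x}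

/-- `φ(x) = ((x_n)_+)^s (a·x + b)`. -/
noncomputable def phiPlane (d : ℕ) (s : ℝ) (a : EuclideanSpace ℝ (Fin (d + 1))) (b : ℝ)
    (x : EuclideanSpace ℝ (Fin (d + 1))) : ℝ :=
  (max (x (Fin.last d)) 0) ^ s * (⟪a, x⟫ + b)

/-- positive part to the power s -/
noncomputable def ppw (s z : ℝ) : ℝ := (max z 0) ^ s

/-- second difference of ppw -/
noncomputable def qq (s τ ρ : ℝ) : ℝ := (ppw s (τ + ρ) + ppw s (τ - ρ)) / 2 - ppw s τ

lemma ppw_pos {s z : ℝ} (hz : 0 ≤ z) : ppw s z = z ^ s := by simp [ppw, hz]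

lemma ppw_neg {s z : ℝ} (hs : s ≠ 0) (hz : z ≤ 0) : ppw s z = 0 := by
  simp [ppw, hz, Real.zero_rpow hs]

lemma ppw_mul {s τ z : ℝ} (hτ : 0 ≤ τ) : ppw s (τ * z) = τ ^ s * ppw s z := by
  unfold ppw
  rw [← Real.mul_rpow hτ (le_max_right _ _), mul_max_of_nonneg _ _ hτ, mul_zero]

lemma ppw_cont {s : ℝ} (hs : 0 ≤ s) : Continuous (ppw s) := by
  unfold ppw
  exact (continuous_id.max continuous_const).rpow_const (fun _ => Or.inr hs)

lemma qq_neg (s τ ρ : ℝ) : qq s τ (-ρ) = qq s τ ρ := by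
  unfold qq
  rw [← sub_eq_add_neg, sub_neg_eq_add, add_comm (ppw s (τ - ρ))]

lemma qq_abs (s τ ρ : ℝ) : qq s τ |ρ| = qq s τ ρ := by
  rcases abs_cases ρ with ⟨h, _⟩ | ⟨h, _⟩ <;> simp [h, qq_neg]

lemma qq_scale {s τ ρ : ℝ} (hτ : 0 < τ) : qq s τ ρ = τ ^ s * qq s 1 (τ⁻¹ * ρ) := by
  have h1 : τ + ρ = τ * (1 + τ⁻¹ * ρ) := by field_simp
  have h2 : τ - ρ = τ * (1 - τ⁻¹ * ρ) := by field_simp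
  have h3 : ppw s τ = τ ^ s * ppw s 1 := by rw [← ppw_mul hτ.le, mul_one]
  unfold qq
  rw [h1, h2, h3, ppw_mul hτ.le, ppw_mul hτ.le]; ring

lemma qq_one_small {s r : ℝ} (hs0 : 0 < s) (hs1 : s < 1) (h0 : 0 ≤ r) (h1 : r ≤ 1) :
    |qq s 1 r| ≤ r ^ 2 := by
  unfold qq
  rw [ppw_pos (by linarith), ppw_pos (by linarith), ppw_pos (by linarith), Real.one_rpow]
  have a1 := rpow_one_add_le_one_add_mul_self (s := r) (by linarith) hs0.le hs1.le
  have a2 := rpow_one_add_le_one_add_mul_self (s := -r) (by linarith) hs0.le hs1.le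
  rw [← sub_eq_add_neg] at a2
  have hp : 0 ≤ (1 + r) ^ s := Real.rpow_nonneg (by linarith) _
  have hm : 0 ≤ (1 - r) ^ s := Real.rpow_nonneg (by linarith) _
  have hprod : (1 + r) ^ s * (1 - r) ^ s = (1 - r ^ 2) ^ s := by
    rw [← Real.mul_rpow (by linarith) (by linarith)]; ring_nf
  have hr2 : 0 ≤ 1 - r ^ 2 := by nlinarith
  have hge : (1 - r ^ 2) ^ (2:ℝ) ≤ (1 - r ^ 2) ^ s := by
    rcases hr2.eq_or_lt with h | h
    · rw [← h, Real.zero_rpow hs0.ne']; simp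
    · exact Real.rpow_le_rpow_of_exponent_ge h (by nlinarith) (by linarith)
  rw [Real.rpow_two] at hge
  have : 1 - r ^ 2 ≤ ((1 + r) ^ s + (1 - r) ^ s) / 2 := by
    apply (sq_le_sq₀ hr2 (by linarith)).1
    nlinarith [sq_nonneg ((1 + r) ^ s - (1 - r) ^ s)]
  rw [abs_le]; constructor <;> linarith

lemma qq_one_large {s r : ℝ} (hs0 : 0 < s) (hs1 : s < 1) (h1 : 1 ≤ r) :
    |qq s 1 r| ≤ r ^ s := by
  unfold qq
  rw [ppw_pos (by linarith), ppw_neg hs0.ne' (by linarith), ppw_pos (by linarith), Real.one_rpow]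
  have a1 : (1 + r) ^ s ≤ (2 * r) ^ s := Real.rpow_le_rpow (by linarith) (by linarith) hs0.le
  rw [Real.mul_rpow (by norm_num) (by linarith)] at a1
  have a2 : (2:ℝ) ^ s ≤ 2 := by
    simpa using Real.rpow_le_rpow_of_exponent_le (x := (2:ℝ)) (by norm_num) hs1.le
  have a3 : 1 ≤ r ^ s := Real.one_le_rpow h1 hs0.le
  have hp : 0 ≤ (1 + r) ^ s := Real.rpow_nonneg (by linarith) _
  rw [abs_le]; constructor <;> nlinarith

lemma sq_le_rpow_s {s r : ℝ} (hs0 : 0 < s) (hs1 : s < 1) (h0 : 0 ≤ r) (h1 : r ≤ 1) :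
    r ^ 2 ≤ r ^ s := by
  rcases h0.eq_or_lt with h | h
  · rw [← h, Real.zero_rpow hs0.ne']; simp
  · rw [← Real.rpow_two]
    exact Real.rpow_le_rpow_of_exponent_ge h h1 (by linarith)

lemma rpow_s_le_sq {s r : ℝ} (hs1 : s < 1) (h1 : 1 ≤ r) :
    r ^ s ≤ r ^ 2 := by
  rw [← Real.rpow_two]
  exact Real.rpow_le_rpow_of_exponent_le h1 (by linarith)

lemma qq_one_bd {s r : ℝ} (hs0 : 0 < s) (hs1 : s < 1) (h0 : 0 ≤ r) :
    |qq s 1 r| ≤ r ^ 2 ∧ |qq s 1 r| ≤ r ^ s := by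
  rcases le_total r 1 with h | h
  · have := qq_one_small hs0 hs1 h0 h
    exact ⟨this, this.trans (sq_le_rpow_s hs0 hs1 h0 h)⟩
  · have := qq_one_large hs0 hs1 h
    exact ⟨this.trans (rpow_s_le_sq hs1 h), this⟩

lemma qq_bd {s τ ρ : ℝ} (hs0 : 0 < s) (hs1 : s < 1) (hτ : 0 < τ) :
    |qq s τ ρ| ≤ τ ^ (s - 2) * ρ ^ 2 ∧ |qq s τ ρ| ≤ |ρ| ^ s := by
  rw [← qq_abs, qq_scale hτ, abs_mul, abs_of_nonneg (Real.rpow_nonneg hτ.le _)]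
  have h := qq_one_bd (r := τ⁻¹ * |ρ|) hs0 hs1 (by positivity)
  have hp : 0 ≤ τ ^ s := by positivity
  refine ⟨(mul_le_mul_of_nonneg_left h.1 hp).trans_eq ?_,
    (mul_le_mul_of_nonneg_left h.2 hp).trans_eq ?_⟩
  · rw [Real.rpow_sub hτ, Real.rpow_two, mul_pow, sq_abs]; field_simp
  · rw [Real.mul_rpow (by positivity) (by positivity), Real.inv_rpow hτ.le]; field_simp

/-- dominating radial weight -/
noncomputable def mw (s r : ℝ) : ℝ := min (r ^ 2) (r ^ s) * r ^ (-1 - 2 * s)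

lemma mw_int {s : ℝ} (hs0 : 0 < s) (hs1 : s < 1) : IntegrableOn (mw s) (Set.Ioi 0) := by
  have hmeas : Measurable (mw s) := by unfold mw; fun_prop
  rw [← Set.Ioc_union_Ioi_eq_Ioi (zero_le_one (α := ℝ))]
  refine IntegrableOn.union ?_ ?_
  · have h := (intervalIntegral.intervalIntegrable_rpow' (a := 0) (b := 1)
      (r := 1 - 2 * s) (by linarith))
    rw [intervalIntegrable_iff_integrableOn_Ioc_of_le zero_le_one] at h
    refine Integrable.mono' h hmeas.aestronglyMeasurable ?_
    filter_upwards [ae_restrict_mem measurableSet_Ioc] with r hr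
    have : 0 < r := hr.1
    rw [Real.norm_of_nonneg (by unfold mw; positivity)]
    unfold mw
    calc _ ≤ r ^ 2 * r ^ (-1 - 2 * s) := by gcongr; exact min_le_left _ _
      _ = _ := by rw [← Real.rpow_two, ← Real.rpow_add this]; ring_nf
  · have h := integrableOn_Ioi_rpow_of_lt (a := -1 - s) (by linarith) zero_lt_one
    refine Integrable.mono' h hmeas.aestronglyMeasurable ?_
    filter_upwards [ae_restrict_mem measurableSet_Ioi] with r hr
    have : 0 < r := zero_lt_one.trans hr
    rw [Real.norm_of_nonneg (by unfold mw; positivity)]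
    unfold mw
    calc _ ≤ r ^ s * r ^ (-1 - 2 * s) := by gcongr; exact min_le_right _ _
      _ = _ := by rw [← Real.rpow_add this]; ring_nf

/-- auxiliary weight -/
noncomputable def ww (s u : ℝ) : ℝ := u ^ (-2 * s) * ppw (s - 1) (1 - u)

lemma ppw_meas (p : ℝ) : Measurable (ppw p) := by unfold ppw; fun_prop

lemma ww_meas (s : ℝ) : Measurable (ww s) := by
  unfold ww; have := ppw_meas (s - 1); fun_prop

lemma ppw_ii {p : ℝ} (hp : -1 < p) (hp0 : p ≠ 0) (a b : ℝ) :
    IntervalIntegrable (ppw p) volume a b := by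
  refine (intervalIntegral.intervalIntegrable_rpow' (a := a) (b := b) hp).mono_fun
    (ppw_meas p).aestronglyMeasurable (Filter.Eventually.of_forall fun z => ?_)
  rcases le_total z 0 with h | h
  · simp only [ppw_neg hp0 h, norm_zero]; positivity
  · simp only [ppw_pos h, le_refl]

lemma ww_ii {s : ℝ} (hs0 : 0 < s) (hs1 : s < 1) {a b : ℝ} (ha : 0 < a) (hb : 0 < b) :
    IntervalIntegrable (ww s) volume a b := by
  have h1 : IntervalIntegrable (fun u => ppw (s - 1) (1 - u)) volume a b := by
    have := (ppw_ii (p := s - 1) (by linarith) (by linarith) (1 - a) (1 - b)).comp_sub_left 1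
    simpa using this
  have h2 : ContinuousOn (fun u : ℝ => u ^ (-2 * s)) (Set.uIcc a b) := by
    intro u hu
    have : 0 < u := lt_of_lt_of_le (lt_min ha hb) hu.1
    exact (Real.continuousAt_rpow_const _ _ (Or.inl this.ne')).continuousWithinAt
  exact h1.continuousOn_mul h2

lemma ppw_hasDeriv {p z : ℝ} (hp : p ≠ 0) (hp1 : p - 1 ≠ 0) (hz : z ≠ 0) :
    HasDerivAt (ppw p) (p * ppw (p - 1) z) z := by
  rcases lt_or_gt_of_ne hz with h | h
  · rw [ppw_neg hp1 h.le, mul_zero]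
    refine (hasDerivAt_const z (0:ℝ)).congr_of_eventuallyEq ?_
    filter_upwards [eventually_lt_nhds h] with y hy
    exact ppw_neg hp hy.le
  · rw [ppw_pos h.le]
    refine (Real.hasDerivAt_rpow_const (Or.inl h.ne')).congr_of_eventuallyEq ?_
    filter_upwards [eventually_gt_nhds h] with y hy
    exact ppw_pos hy.le

lemma ppw_contAt {p z : ℝ} (hp : p ≠ 0) (hz : z ≠ 0) : ContinuousAt (ppw p) z := by
  unfold ppw
  rcases lt_or_gt_of_ne hz with h | h
  · refine (continuousAt_const (y := (0:ℝ))).congr ?_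
    filter_upwards [eventually_lt_nhds h] with y hy
    exact (ppw_neg hp hy.le).symm
  · refine (Real.continuousAt_rpow_const z p (Or.inl h.ne')).congr ?_
    filter_upwards [eventually_gt_nhds h] with y hy
    exact (ppw_pos hy.le).symm

/-- primitive of ww -/
noncomputable def WW (s x : ℝ) : ℝ := ∫ u in (1/2:ℝ)..x, ww s u

lemma WW_cont {s : ℝ} (hs0 : 0 < s) (hs1 : s < 1) {x : ℝ} (hx : 0 < x) :
    ContinuousAt (WW s) x := by
  have h := intervalIntegral.continuousOn_primitive_interval' (a := 1/2) (μ := volume) (f := ww s)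
    (b₁ := min (x/2) (1/2)) (b₂ := max (x+1) 1)
    (ww_ii hs0 hs1 (lt_min (by linarith) (by norm_num)) (lt_of_lt_of_le one_pos (le_max_right _ _)))
    (by
      rw [Set.uIcc_of_le ((min_le_right _ _).trans ((by norm_num : (1/2:ℝ) ≤ 1).trans (le_max_right _ _)))]
      exact ⟨min_le_right _ _, (by norm_num : (1/2:ℝ) ≤ 1).trans (le_max_right _ _)⟩)
  rw [Set.uIcc_of_le ((min_le_right _ _).trans ((by norm_num : (1/2:ℝ) ≤ 1).trans (le_max_right _ _)))] at h
  exact h.continuousAt (Icc_mem_nhds ((min_le_left _ _).trans_lt (by linarith))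
    (lt_of_lt_of_le (by linarith) (le_max_left _ _)))

lemma WW_deriv {s : ℝ} (hs0 : 0 < s) (hs1 : s < 1) {x : ℝ} (hx : 0 < x) (hx1 : x ≠ 1) :
    HasDerivAt (WW s) (ww s x) x := by
  refine intervalIntegral.integral_hasDerivAt_right (ww_ii hs0 hs1 (by norm_num) hx)
    (ww_meas s).stronglyMeasurable.stronglyMeasurableAtFilter ?_
  unfold ww
  refine (Real.continuousAt_rpow_const _ _ (Or.inl hx.ne')).mul ?_
  refine ContinuousAt.comp (f := fun u : ℝ => 1 - u) (g := ppw (s-1)) (ppw_contAt (by linarith) ?_)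
    (by fun_prop)
  exact sub_ne_zero.2 (Ne.symm hx1)

/-- antiderivative -/
noncomputable def AA (s x : ℝ) : ℝ :=
  -(qq s 1 x * x ^ (-2 * s) / (2 * s)) - (1/4) * ∫ u in (x / (1 + x))..x, ww s u

lemma AA_eq {s : ℝ} (hs0 : 0 < s) (hs1 : s < 1) {x : ℝ} (hx : 0 < x) :
    AA s x = -(qq s 1 x * x ^ (-2 * s) / (2 * s)) - (1/4) * (WW s x - WW s (x / (1 + x))) := by
  unfold AA WW
  have hd : 0 < x / (1 + x) := by positivity
  rw [intervalIntegral.integral_interval_sub_left (ww_ii hs0 hs1 (by norm_num) hx)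
    (ww_ii hs0 hs1 (by norm_num) hd)]

lemma qq_cont {s : ℝ} (hs0 : 0 < s) (τ : ℝ) : Continuous (qq s τ) := by
  unfold qq
  have := ppw_cont hs0.le
  fun_prop

lemma AA_deriv {s : ℝ} (hs0 : 0 < s) (hs1 : s < 1) {x : ℝ} (hx : 0 < x) (hx1 : x ≠ 1) :
    HasDerivAt (AA s) (qq s 1 x * x ^ (-1 - 2 * s)) x := by
  have hd : 0 < x / (1 + x) := by positivity
  have hd1 : x / (1 + x) ≠ 1 := by
    rw [Ne, div_eq_one_iff_eq (by positivity)]; linarith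
  have hq : HasDerivAt (qq s 1) ((s * ppw (s-1) (1 + x) * 1 + s * ppw (s-1) (1 - x) * (-1)) / 2 - 0) x := by
    unfold qq
    refine HasDerivAt.sub (HasDerivAt.div_const (HasDerivAt.add ?_ ?_) 2) (hasDerivAt_const _ _)
    · exact (ppw_hasDeriv hs0.ne' (by linarith) (by linarith)).comp x ((hasDerivAt_id x).const_add 1)
    · exact (ppw_hasDeriv hs0.ne' (by linarith) (sub_ne_zero.2 (Ne.symm hx1))).comp x
        ((hasDerivAt_id x).const_sub 1)
  have hr : HasDerivAt (fun x : ℝ => x ^ (-2 * s)) _ x :=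
    Real.hasDerivAt_rpow_const (Or.inl hx.ne')
  have hδ : HasDerivAt (fun x : ℝ => x / (1 + x)) ((1 * (1 + x) - x * 1) / (1 + x) ^ 2) x :=
    (hasDerivAt_id x).div ((hasDerivAt_id x).const_add 1) (by positivity)
  have hW := (WW_deriv hs0 hs1 hx hx1).sub ((WW_deriv hs0 hs1 hd hd1).comp x hδ)
  have H := (((hq.mul hr).div_const (2 * s)).neg).sub (hW.const_mul (1/4))
  have he : AA s =ᶠ[nhds x] fun x => -(qq s 1 x * x ^ (-2 * s) / (2 * s)) - (1/4) * (WW s x - WW s (x / (1 + x))) := by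
    filter_upwards [eventually_gt_nhds hx] with y hy
    exact AA_eq hs0 hs1 hy
  refine (H.congr_of_eventuallyEq he).congr_deriv ?_
  have e1 : ww s (x / (1 + x)) * ((1 * (1 + x) - x * 1) / (1 + x) ^ 2)
      = x ^ (-2 * s) * (1 + x) ^ (s - 1) := by
    have h1x : 0 < 1 + x := by linarith
    unfold ww
    have : 1 - x / (1 + x) = (1 + x)⁻¹ := by field_simp; ring
    rw [this, ppw_pos (by positivity), Real.div_rpow hx.le h1x.le, Real.inv_rpow h1x.le,
      ← Real.rpow_neg h1x.le, div_eq_mul_inv, ← Real.rpow_neg h1x.le]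
    have : (1 * (1 + x) - x * 1) / (1 + x) ^ 2 = (1 + x) ^ (-2 : ℝ) := by
      rw [Real.rpow_neg h1x.le, Real.rpow_two]; field_simp; ring
    rw [this, mul_assoc, mul_assoc, ← Real.rpow_add h1x, ← Real.rpow_add h1x]
    ring_nf
  rw [e1]
  have e2 : (-2 * s - 1) = -1 - 2 * s := by ring
  have e3 : ppw (s - 1) (1 + x) = (1 + x) ^ (s - 1) := ppw_pos (by linarith)
  rw [e2, e3]
  unfold ww
  field_simp
  ring

lemma AA_small {s : ℝ} (hs0 : 0 < s) (hs1 : s < 1) {x : ℝ} (hx : 0 ≤ x) (hx1 : x ≤ 1/2) :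
    |AA s x| ≤ (1 / (2 * s) + 2) * x ^ (2 - 2 * s) := by
  rcases hx.eq_or_lt with h | hx
  · rw [← h, Real.zero_rpow (by linarith)]
    simp [AA, qq]
  have hd : 0 < x / (1 + x) := by positivity
  have hdx : x / (1 + x) ≤ x := div_le_self hx.le (by linarith)
  have hd2 : x / 2 ≤ x / (1 + x) := by gcongr; linarith
  have b1 : |qq s 1 x * x ^ (-2 * s) / (2 * s)| ≤ 1 / (2 * s) * x ^ (2 - 2 * s) := by
    rw [abs_div, abs_mul, abs_of_pos (by positivity : (0:ℝ) < 2 * s),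
      abs_of_pos (by positivity : 0 < x ^ (-2 * s))]
    have := (qq_one_bd hs0 hs1 hx.le).1
    have e : x ^ (2 - 2 * s) = x ^ 2 * x ^ (-2 * s) := by
      rw [← Real.rpow_two, ← Real.rpow_add hx]; ring_nf
    rw [e, div_eq_mul_inv, mul_comm, one_div]
    gcongr
  have b2 : |∫ u in (x / (1 + x))..x, ww s u| ≤ 8 * x ^ (-2 * s) * |x - x / (1 + x)| := by
    rw [← Real.norm_eq_abs]
    refine intervalIntegral.norm_integral_le_of_norm_le_const fun u hu => ?_
    rw [Set.uIoc_of_le hdx] at hu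
    have hu0 : 0 < u := hd.trans hu.1
    have hu1 : u ≤ 1/2 := hu.2.trans hx1
    unfold ww
    rw [ppw_pos (by linarith), Real.norm_of_nonneg
      (mul_nonneg (Real.rpow_nonneg hu0.le _) (Real.rpow_nonneg (by linarith) _))]
    have c1 : u ^ (-2 * s) ≤ (x / 2) ^ (-2 * s) :=
      Real.rpow_le_rpow_of_nonpos (by linarith) (by linarith [hu.1]) (by linarith)
    have c2 : (x / 2) ^ (-2 * s) ≤ 4 * x ^ (-2 * s) := by
      rw [Real.div_rpow hx.le (by norm_num), div_eq_mul_inv, ← Real.rpow_neg (by norm_num), mul_comm]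
      gcongr
      calc (2:ℝ) ^ (-(-2 * s)) ≤ 2 ^ (2:ℝ) :=
            Real.rpow_le_rpow_of_exponent_le (by norm_num) (by linarith)
        _ = 4 := by norm_num
    have c3 : (1 - u) ^ (s - 1) ≤ 2 := by
      calc (1 - u) ^ (s - 1) ≤ (1/2:ℝ) ^ (s - 1) :=
            Real.rpow_le_rpow_of_nonpos (by norm_num) (by linarith) (by linarith)
        _ ≤ (1/2:ℝ) ^ (-1:ℝ) :=
            Real.rpow_le_rpow_of_exponent_ge (by norm_num) (by norm_num) (by linarith)
        _ = 2 := by rw [Real.rpow_neg_one]; norm_num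
    calc _ ≤ (4 * x ^ (-2 * s)) * 2 := by
          apply mul_le_mul (c1.trans c2) c3 (Real.rpow_nonneg (by linarith) _) (by positivity)
      _ = _ := by ring
  have b3 : |x - x / (1 + x)| ≤ x ^ 2 := by
    rw [abs_of_nonneg (by linarith)]
    have : x - x / (1 + x) = x ^ 2 / (1 + x) := by field_simp; ring
    rw [this]
    exact div_le_self (by positivity) (by linarith)
  have b4 : |∫ u in (x / (1 + x))..x, ww s u| ≤ 8 * x ^ (2 - 2 * s) := by
    refine b2.trans ?_
    have e : x ^ (2 - 2 * s) = x ^ (-2 * s) * x ^ 2 := by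
      rw [← Real.rpow_two, ← Real.rpow_add hx]; ring_nf
    rw [e, mul_assoc]
    gcongr
  unfold AA
  rw [abs_le] at *
  constructor <;> linarith [b1.1, b1.2, b4.1, b4.2]

lemma AA_zero {s : ℝ} (hs0 : 0 < s) (hs1 : s < 1) : AA s 0 = 0 := by
  have := AA_small hs0 hs1 (x := 0) le_rfl (by norm_num)
  rw [Real.zero_rpow (by linarith), mul_zero] at this
  exact abs_nonpos_iff.1 this

lemma AA_contOn {s : ℝ} (hs0 : 0 < s) (hs1 : s < 1) : ContinuousOn (AA s) (Set.Ici 0) := by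
  intro x hx
  rcases (Set.mem_Ici.1 hx).eq_or_lt with h | h
  · subst h
    have hlim : Filter.Tendsto (fun x : ℝ => (1 / (2 * s) + 2) * x ^ (2 - 2 * s))
        (nhdsWithin 0 (Set.Ici 0)) (nhds 0) := by
      have : ContinuousAt (fun x : ℝ => (1 / (2 * s) + 2) * x ^ (2 - 2 * s)) 0 :=
        continuousAt_const.mul (Real.continuousAt_rpow_const _ _ (Or.inr (by linarith)))
      have h2 := this.tendsto
      simp only [Real.zero_rpow (show 2 - 2 * s ≠ 0 by linarith), mul_zero] at h2
      exact h2.mono_left nhdsWithin_le_nhds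
    rw [ContinuousWithinAt, AA_zero hs0 hs1]
    refine squeeze_zero_norm' ?_ hlim
    filter_upwards [self_mem_nhdsWithin, mem_nhdsWithin_of_mem_nhds
      (eventually_le_nhds (show (0:ℝ) < 1/2 by norm_num))] with y hy hy2
    exact AA_small hs0 hs1 hy hy2
  · refine ContinuousAt.continuousWithinAt ?_
    have he : AA s =ᶠ[nhds x] fun x => -(qq s 1 x * x ^ (-2 * s) / (2 * s)) - (1/4) * (WW s x - WW s (x / (1 + x))) := by
      filter_upwards [eventually_gt_nhds h] with y hy
      exact AA_eq hs0 hs1 hy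
    refine ContinuousAt.congr ?_ he.symm
    have hd : 0 < x / (1 + x) := by positivity
    have c1 : ContinuousAt (fun x : ℝ => x ^ (-2 * s)) x :=
      Real.continuousAt_rpow_const _ _ (Or.inl h.ne')
    have c2 := (qq_cont hs0 1).continuousAt (x := x)
    have c3 : ContinuousAt (fun x : ℝ => x / (1 + x)) x :=
      continuousAt_id.div (by fun_prop) (by positivity)
    have c4 : ContinuousAt (fun x : ℝ => WW s (x / (1 + x))) x :=
      ContinuousAt.comp (g := WW s) (WW_cont hs0 hs1 hd) c3
    exact ((c2.mul c1).div_const _).neg.sub (continuousAt_const.mul ((WW_cont hs0 hs1 h).sub c4))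

lemma AA_top {s : ℝ} (hs0 : 0 < s) (hs1 : s < 1) :
    Filter.Tendsto (AA s) Filter.atTop (nhds 0) := by
  have h1 : Filter.Tendsto (fun x => qq s 1 x * x ^ (-2 * s)) Filter.atTop (nhds 0) := by
    refine squeeze_zero_norm' ?_ (tendsto_rpow_neg_atTop hs0)
    filter_upwards [Filter.eventually_gt_atTop 0] with x hx
    rw [norm_mul, Real.norm_eq_abs, Real.norm_of_nonneg (Real.rpow_nonneg hx.le _)]
    calc _ ≤ x ^ s * x ^ (-2 * s) := by gcongr; exact (qq_one_bd hs0 hs1 hx.le).2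
      _ = _ := by rw [← Real.rpow_add hx]; ring_nf
  have h2 : Filter.Tendsto (fun x : ℝ => x / (1 + x)) Filter.atTop (nhds 1) := by
    have : Filter.Tendsto (fun x : ℝ => 1 - (1 + x)⁻¹) Filter.atTop (nhds (1 - 0)) :=
      tendsto_const_nhds.sub (tendsto_inv_atTop_zero.comp
        (Filter.tendsto_atTop_add_const_left _ _ Filter.tendsto_id))
    rw [sub_zero] at this
    refine this.congr' ?_
    filter_upwards [Filter.eventually_gt_atTop 0] with x hx
    field_simp; ring
  have h3 : Filter.Tendsto (fun x : ℝ => WW s (x / (1 + x))) Filter.atTop (nhds (WW s 1)) :=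
    (WW_cont hs0 hs1 one_pos).tendsto.comp h2
  have h4 : Filter.Tendsto (fun x => -(qq s 1 x * x ^ (-2 * s) / (2 * s))
      - (1/4) * (WW s 1 - WW s (x / (1 + x)))) Filter.atTop
      (nhds (-(0 / (2 * s)) - (1/4) * (WW s 1 - WW s 1))) :=
    (h1.div_const _).neg.sub ((tendsto_const_nhds.sub h3).const_mul _)
  simp only [zero_div, neg_zero, sub_self, mul_zero] at h4
  refine h4.congr' ?_
  filter_upwards [Filter.eventually_gt_atTop 1] with x hx
  rw [AA_eq hs0 hs1 (by linarith)]
  have : WW s x = WW s 1 := by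
    unfold WW
    rw [← intervalIntegral.integral_add_adjacent_intervals
      (ww_ii hs0 hs1 (by norm_num : (0:ℝ) < 1/2) one_pos) (ww_ii hs0 hs1 one_pos (by linarith))]
    rw [add_eq_left]
    rw [intervalIntegral.integral_congr (g := fun _ => 0)]
    · simp
    · intro u hu
      rw [Set.uIcc_of_le hx.le] at hu
      simp only [ww]
      rw [ppw_neg (by linarith) (by linarith [hu.1]), mul_zero]
  rw [this]

lemma dom_int {s : ℝ} (hs0 : 0 < s) (hs1 : s < 1) {p : ℝ → ℝ} (hp : Measurable p) {C : ℝ}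
    (h1 : ∀ ρ, 0 < ρ → |p ρ| ≤ C * min (ρ ^ 2) (ρ ^ s)) :
    IntegrableOn (fun ρ => p ρ * ρ ^ (-1 - 2 * s)) (Set.Ioi 0) := by
  refine Integrable.mono' ((mw_int hs0 hs1).const_mul C)
    (by fun_prop) ?_
  filter_upwards [ae_restrict_mem measurableSet_Ioi] with r hr
  have : 0 < r := hr
  rw [norm_mul, Real.norm_eq_abs, Real.norm_of_nonneg (by positivity)]
  unfold mw
  rw [← mul_assoc]
  gcongr
  exact h1 r this

lemma qq_one_int {s : ℝ} (hs0 : 0 < s) (hs1 : s < 1) :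
    ∫ r in Set.Ioi (0:ℝ), qq s 1 r * r ^ (-1 - 2 * s) = 0 := by
  have hInt : IntegrableOn (fun r => qq s 1 r * r ^ (-1 - 2 * s)) (Set.Ioi 0) := by
    refine dom_int hs0 hs1 (qq_cont hs0 1).measurable (C := 1) fun ρ hρ => ?_
    rw [one_mul]
    exact le_min (qq_one_bd hs0 hs1 hρ.le).1 (qq_one_bd hs0 hs1 hρ.le).2
  have h1 := intervalIntegral_tendsto_integral_Ioi 0 hInt Filter.tendsto_id
  refine tendsto_nhds_unique h1 ((AA_top hs0 hs1).congr' ?_)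
  filter_upwards [Filter.eventually_gt_atTop 0] with T hT
  symm
  have := integral_eq_of_hasDerivAt_off_countable (AA s) (fun r => qq s 1 r * r ^ (-1 - 2 * s))
    (a := 0) (b := T) (s := {1}) (Set.countable_singleton _)
    ((AA_contOn hs0 hs1).mono (by rw [Set.uIcc_of_le hT.le]; exact Set.Icc_subset_Ici_self))
    (by
      rintro x ⟨hx, hx1⟩
      rw [min_eq_left hT.le] at hx
      exact AA_deriv hs0 hs1 hx.1 (by simpa using hx1))
    (by
      rw [intervalIntegrable_iff_integrableOn_Ioc_of_le hT.le]
      exact hInt.mono_set Set.Ioc_subset_Ioi_self)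
  rw [AA_zero hs0 hs1, sub_zero] at this
  exact this

lemma scale_int {s c : ℝ} (hc : 0 < c) {p : ℝ → ℝ}
    (h : ∫ r in Set.Ioi (0:ℝ), p r * r ^ (-1 - 2 * s) = 0) :
    ∫ r in Set.Ioi (0:ℝ), p (c * r) * r ^ (-1 - 2 * s) = 0 := by
  have h1 := integral_comp_mul_left_Ioi (fun r => p r * r ^ (-1 - 2 * s)) 0 hc
  rw [mul_zero, h, smul_zero] at h1
  have h2 : ∫ r in Set.Ioi (0:ℝ), p (c * r) * (c * r) ^ (-1 - 2 * s)
      = c ^ (-1 - 2 * s) * ∫ r in Set.Ioi (0:ℝ), p (c * r) * r ^ (-1 - 2 * s) := by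
    rw [← integral_const_mul]
    refine setIntegral_congr_fun measurableSet_Ioi fun r hr => ?_
    have : 0 < r := hr
    rw [Real.mul_rpow hc.le this.le]; ring
  rw [h2] at h1
  exact (mul_eq_zero.1 h1).resolve_left (by positivity)

/-- one-dimensional even profiles annihilated by the kernel -/
structure Good (s : ℝ) (p : ℝ → ℝ) : Prop where
  meas : Measurable p
  even : ∀ ρ, p |ρ| = p ρ
  bd : ∃ C, 0 ≤ C ∧ ∀ ρ, |p ρ| ≤ C * min (ρ ^ 2) (|ρ| ^ s)
  int : ∫ r in Set.Ioi (0:ℝ), p r * r ^ (-1 - 2 * s) = 0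

lemma qq_bd' {s t τ ρ : ℝ} (hs0 : 0 < s) (hs1 : s < 1) (ht : 0 < t) (hτ : t ≤ τ) :
    |qq s τ ρ| ≤ (t ^ (s - 2) + 1) * min (ρ ^ 2) (|ρ| ^ s) := by
  have hp : 0 < t ^ (s - 2) := by positivity
  rw [mul_min_of_nonneg _ _ (by linarith)]
  obtain ⟨h1, h2⟩ := qq_bd (ρ := ρ) hs0 hs1 (ht.trans_le hτ)
  refine le_min (h1.trans ?_) (h2.trans ?_)
  · have : τ ^ (s - 2) ≤ t ^ (s - 2) := Real.rpow_le_rpow_of_nonpos ht hτ (by linarith)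
    gcongr
    linarith
  · exact le_mul_of_one_le_left (by positivity) (by linarith)

lemma qq_int {s τ : ℝ} (hs0 : 0 < s) (hs1 : s < 1) (hτ : 0 < τ) :
    ∫ r in Set.Ioi (0:ℝ), qq s τ r * r ^ (-1 - 2 * s) = 0 := by
  have h := scale_int (inv_pos.2 hτ) (qq_one_int hs0 hs1)
  simp_rw [qq_scale hτ, mul_assoc]
  rw [integral_const_mul, h, mul_zero]

lemma qq_good {s τ : ℝ} (hs0 : 0 < s) (hs1 : s < 1) (hτ : 0 < τ) : Good s (qq s τ) :=
  ⟨(qq_cont hs0 τ).measurable, qq_abs s τ,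
    ⟨τ ^ (s - 2) + 1, by positivity, fun ρ => qq_bd' hs0 hs1 hτ le_rfl⟩, qq_int hs0 hs1 hτ⟩

/-- averaged second difference -/
noncomputable def QQ (s t k ρ : ℝ) : ℝ := ∫ w in (0:ℝ)..k, qq s (t + w) ρ

lemma qq_cont2 {s : ℝ} (hs0 : 0 < s) (t : ℝ) : Continuous (fun z : ℝ × ℝ => qq s (t + z.1) z.2) := by
  unfold qq
  have := ppw_cont hs0.le
  fun_prop

lemma QQ_good {s t k : ℝ} (hs0 : 0 < s) (hs1 : s < 1) (ht : 0 < t) (hk : 0 ≤ k) :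
    Good s (QQ s t k) := by
  have hc := qq_cont2 hs0 t
  refine ⟨?_, ?_, ⟨(t ^ (s - 2) + 1) * k, by positivity, ?_⟩, ?_⟩
  · refine Continuous.measurable ?_
    unfold QQ
    exact intervalIntegral.continuous_parametric_intervalIntegral_of_continuous'
      (f := fun ρ w => qq s (t + w) ρ) (hc.comp continuous_swap) 0 k
  · intro ρ; unfold QQ; simp_rw [qq_abs]
  · intro ρ
    have := intervalIntegral.norm_integral_le_of_norm_le_const (a := 0) (b := k)
      (f := fun w => qq s (t + w) ρ) (C := (t ^ (s - 2) + 1) * min (ρ ^ 2) (|ρ| ^ s)) (by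
        intro w hw
        rw [Set.uIoc_of_le hk] at hw
        exact qq_bd' hs0 hs1 ht (by linarith [hw.1]))
    rw [sub_zero, abs_of_nonneg hk, Real.norm_eq_abs] at this
    unfold QQ
    linarith
  · unfold QQ
    have h1 : ∀ r : ℝ, (∫ w in (0:ℝ)..k, qq s (t + w) r) * r ^ (-1 - 2 * s)
        = ∫ w in (0:ℝ)..k, qq s (t + w) r * r ^ (-1 - 2 * s) := fun r =>
      (intervalIntegral.integral_mul_const _ _).symm
    simp_rw [h1]
    rw [← intervalIntegral_integral_swap (f := fun w r => qq s (t + w) r * r ^ (-1 - 2 * s))]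
    · rw [intervalIntegral.integral_congr (g := fun _ => (0:ℝ))]
      · simp
      · intro w hw
        rw [Set.uIcc_of_le hk] at hw
        exact qq_int hs0 hs1 (by linarith [hw.1])
    · have hdom : Integrable (fun z : ℝ × ℝ => (t ^ (s - 2) + 1) * mw s z.2)
          ((volume.restrict (Set.uIoc 0 k)).prod (volume.restrict (Set.Ioi 0))) :=
        Integrable.mul_prod (f := fun _ => t ^ (s - 2) + 1)
          (by
            have : IsFiniteMeasure (volume.restrict (Set.uIoc 0 k)) := by
              rw [Set.uIoc_of_le hk]; infer_instance
            exact integrable_const _) (mw_int hs0 hs1)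
      refine hdom.mono' ?_ ?_
      · have := hc.measurable
        exact Measurable.aestronglyMeasurable (this.mul (measurable_snd.pow_const _))
      · rw [Measure.prod_restrict]
        filter_upwards [ae_restrict_mem (measurableSet_uIoc.prod measurableSet_Ioi)] with z hz
        rw [Set.uIoc_of_le hk] at hz
        have hz2 : 0 < z.2 := hz.2
        have hz1 : 0 < z.1 := hz.1.1
        have := qq_bd' (τ := t + z.1) (ρ := z.2) hs0 hs1 ht (by linarith)
        rw [abs_of_pos hz2] at this
        simp only [Function.uncurry, mw]
        rw [norm_mul, Real.norm_eq_abs, Real.norm_of_nonneg (by positivity), ← mul_assoc]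
        gcongr

lemma ppw_succ {s : ℝ} (hs0 : 0 < s) (z : ℝ) : ppw (1 + s) z = z * ppw s z := by
  rcases le_total z 0 with h | h
  · rw [ppw_neg (by linarith) h, ppw_neg hs0.ne' h, mul_zero]
  · rw [ppw_pos h, ppw_pos h]
    rcases h.eq_or_lt with h | h
    · rw [← h, Real.zero_rpow (by linarith), zero_mul]
    · rw [Real.rpow_add h, Real.rpow_one]

lemma ppw_prim {s : ℝ} (hs0 : 0 < s) (z k : ℝ) :
    (1 + s) * ∫ w in (0:ℝ)..k, ppw s (z + w) = ppw (1 + s) (z + k) - ppw (1 + s) z := by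
  have h1 : ∫ w in (0:ℝ)..k, ppw s (z + w) = ∫ w in (z + 0)..(z + k), ppw s w :=
    intervalIntegral.integral_comp_add_left (fun w => ppw s w) z
  rw [h1, ← intervalIntegral.integral_const_mul, add_zero]
  refine integral_eq_of_hasDerivAt_off_countable (ppw (1 + s)) _ (Set.countable_singleton 0)
    (ppw_cont (by linarith)).continuousOn ?_
    ((continuous_const.mul (ppw_cont hs0.le)).intervalIntegrable _ _)
  rintro x ⟨_, hx⟩
  have := ppw_hasDeriv (p := 1 + s) (z := x) (by linarith) (by simpa using hs0.ne') (by simpa using hx)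
  simpa using this

lemma QQ_eq {s : ℝ} (hs0 : 0 < s) (t k ρ : ℝ) :
    (1 + s) * QQ s t k ρ = ((ppw (1 + s) (t + k + ρ) - ppw (1 + s) (t + ρ))
      + (ppw (1 + s) (t + k - ρ) - ppw (1 + s) (t - ρ))) / 2
      - (ppw (1 + s) (t + k) - ppw (1 + s) t) := by
  have hc := ppw_cont hs0.le
  have i1 : IntervalIntegrable (fun w => ppw s ((t + ρ) + w)) volume 0 k :=
    (hc.comp (continuous_const.add continuous_id)).intervalIntegrable _ _
  have i2 : IntervalIntegrable (fun w => ppw s ((t - ρ) + w)) volume 0 k :=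
    (hc.comp (continuous_const.add continuous_id)).intervalIntegrable _ _
  have i3 : IntervalIntegrable (fun w => ppw s (t + w)) volume 0 k :=
    (hc.comp (continuous_const.add continuous_id)).intervalIntegrable _ _
  have h : QQ s t k ρ = ((∫ w in (0:ℝ)..k, ppw s ((t + ρ) + w))
      + ∫ w in (0:ℝ)..k, ppw s ((t - ρ) + w)) / 2 - ∫ w in (0:ℝ)..k, ppw s (t + w) := by
    rw [← intervalIntegral.integral_add i1 i2, ← intervalIntegral.integral_div,
      ← intervalIntegral.integral_sub ((i1.add i2).div_const 2) i3]
    unfold QQ qq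
    refine intervalIntegral.integral_congr fun w _ => ?_
    rw [show t + w + ρ = t + ρ + w by ring, show t + w - ρ = t - ρ + w by ring]
  have p1 := ppw_prim hs0 (t + ρ) k
  have p2 := ppw_prim hs0 (t - ρ) k
  have p3 := ppw_prim hs0 t k
  rw [show t + k + ρ = t + ρ + k by ring, show t + k - ρ = t - ρ + k by ring, ← p1, ← p2, ← p3, h]
  ring

/-- profile of the increment along a line -/
noncomputable def UU (s t k α η β c r : ℝ) : ℝ :=
  ppw s (t + k + r * c) * (α + η + r * β) - ppw s (t + r * c) * (α + r * β)

/-- its second difference -/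
noncomputable def DD (s t k α η β c r : ℝ) : ℝ :=
  (UU s t k α η β c r + UU s t k α η β c (-r)) / 2 - UU s t k α η β c 0

lemma DD_zero (s t k α η β r : ℝ) : DD s t k α η β 0 r = 0 := by
  unfold DD UU; simp only [mul_zero, add_zero, zero_mul]; ring

lemma DD_eq {s : ℝ} (hs0 : 0 < s) (t k α η β : ℝ) {c : ℝ} (hc : c ≠ 0) (r : ℝ) :
    DD s t k α η β c r = c⁻¹ * ((c * (α + η) - β * (t + k)) * qq s (t + k) (r * c)
      - (c * α - β * t) * qq s t (r * c) + β * (1 + s) * QQ s t k (r * c)) := by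
  have h := QQ_eq hs0 t k (r * c)
  rw [mul_assoc β, h]
  simp only [ppw_succ hs0]
  unfold DD UU qq
  simp only [neg_mul, zero_mul, add_zero, ← sub_eq_add_neg]
  field_simp
  ring

lemma min_scale {s c r : ℝ} (hs0 : 0 < s) (hs1 : s < 1) (hc : c ≠ 0) (hc1 : |c| ≤ 1) (hr : 0 < r) :
    |c|⁻¹ * min ((r * c) ^ 2) (|r * c| ^ s) ≤ |c| ^ (s - 1) * min (r ^ 2) (r ^ s) := by
  have hcp : 0 < |c| := abs_pos.2 hc
  have e : |c| ^ (s - 1) = |c|⁻¹ * |c| ^ s := by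
    rw [Real.rpow_sub hcp, Real.rpow_one]; field_simp
  rw [e, mul_assoc]
  gcongr
  rw [mul_min_of_nonneg _ _ (by positivity), abs_mul, Real.mul_rpow (abs_nonneg _) (abs_nonneg _),
    abs_of_pos hr]
  refine min_le_min ?_ (by rw [mul_comm])
  have := sq_le_rpow_s hs0 hs1 hcp.le hc1
  rw [mul_pow, ← sq_abs c, mul_comm]
  gcongr

lemma Good.int_c {s : ℝ} {p : ℝ → ℝ} (hs0 : 0 < s) (hs1 : s < 1) (hp : Good s p) {c : ℝ} (hc : c ≠ 0) :
    ∫ r in Set.Ioi (0:ℝ), p (r * c) * r ^ (-1 - 2 * s) = 0 := by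
  refine Eq.trans ?_ (scale_int (abs_pos.2 hc) hp.int)
  refine setIntegral_congr_fun measurableSet_Ioi fun r hr => ?_
  have : 0 < r := hr
  rw [← hp.even (r * c), abs_mul, abs_of_pos this, mul_comm r |c|]

lemma Good.integrable_c {s : ℝ} {p : ℝ → ℝ} (hs0 : 0 < s) (hs1 : s < 1) (hp : Good s p) {c : ℝ}
    (hc : c ≠ 0) (hc1 : |c| ≤ 1) :
    IntegrableOn (fun r => p (r * c) * r ^ (-1 - 2 * s)) (Set.Ioi 0) := by
  obtain ⟨C, hC, hb⟩ := hp.bd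
  have hm := hp.meas
  have hcp : 0 < |c| := abs_pos.2 hc
  refine dom_int hs0 hs1 (p := fun r => p (r * c)) (by fun_prop) (C := C * (|c| * |c| ^ (s - 1))) fun r hr => ?_
  refine (hb _).trans ?_
  have := min_scale hs0 hs1 hc hc1 hr
  rw [inv_mul_le_iff₀ hcp] at this
  rw [mul_assoc, mul_assoc]
  gcongr

lemma DD_int {s t k : ℝ} (hs0 : 0 < s) (hs1 : s < 1) (ht : 0 < t) (hk : 0 ≤ k) (α η β c : ℝ)
    (hc1 : |c| ≤ 1) :
    ∫ r in Set.Ioi (0:ℝ), DD s t k α η β c r * r ^ (-1 - 2 * s) = 0 := by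
  rcases eq_or_ne c 0 with rfl | hc
  · simp [DD_zero]
  have g1 := qq_good (τ := t + k) hs0 hs1 (by linarith)
  have g2 := qq_good (τ := t) hs0 hs1 ht
  have g3 := QQ_good hs0 hs1 ht hk
  have j1 := (g1.integrable_c hs0 hs1 hc hc1).const_mul (c⁻¹ * (c * (α + η) - β * (t + k)))
  have j2 := (g2.integrable_c hs0 hs1 hc hc1).const_mul (c⁻¹ * (c * α - β * t))
  have j3 := (g3.integrable_c hs0 hs1 hc hc1).const_mul (c⁻¹ * (β * (1 + s)))
  have e : ∀ r, DD s t k α η β c r * r ^ (-1 - 2 * s) =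
      (c⁻¹ * (c * (α + η) - β * (t + k))) * (qq s (t + k) (r * c) * r ^ (-1 - 2 * s))
      - (c⁻¹ * (c * α - β * t)) * (qq s t (r * c) * r ^ (-1 - 2 * s))
      + (c⁻¹ * (β * (1 + s))) * (QQ s t k (r * c) * r ^ (-1 - 2 * s)) := by
    intro r; rw [DD_eq hs0 t k α η β hc]; ring
  simp_rw [e]
  refine (integral_add (j1.sub j2) j3).trans ?_
  refine (congrArg₂ (· + ·) (integral_sub j1 j2) rfl).trans ?_
  rw [integral_const_mul, integral_const_mul, integral_const_mul, g1.int_c hs0 hs1 hc, g2.int_c hs0 hs1 hc, g3.int_c hs0 hs1 hc]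
  simp

lemma DD_bd {s t k : ℝ} (hs0 : 0 < s) (hs1 : s < 1) (ht : 0 < t) (hk : 0 ≤ k) (α η B : ℝ) :
    ∃ K, 0 ≤ K ∧ ∀ β c r : ℝ, |β| ≤ B → |c| ≤ 1 → 0 < r →
      |DD s t k α η β c r| ≤ K * |c| ^ (s - 1) * min (r ^ 2) (r ^ s) := by
  obtain ⟨C1, hC1, b1⟩ := (qq_good (τ := t + k) hs0 hs1 (by linarith)).bd
  obtain ⟨C2, hC2, b2⟩ := (qq_good (τ := t) hs0 hs1 ht).bd
  obtain ⟨C3, hC3, b3⟩ := (QQ_good hs0 hs1 ht hk).bd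
  refine ⟨(|α + η| + |B| * (t + k)) * C1 + (|α| + |B| * t) * C2 + |B| * (1 + s) * C3,
    by positivity, fun β c r hβ hc1 hr => ?_⟩
  rcases eq_or_ne c 0 with rfl | hc
  · rw [DD_zero, abs_zero]; positivity
  have hβ' : |β| ≤ |B| := hβ.trans (le_abs_self _)
  rw [DD_eq hs0 t k α η β hc, abs_mul, abs_inv]
  have hms := min_scale hs0 hs1 hc hc1 hr
  set m := min ((r * c) ^ 2) (|r * c| ^ s) with hm
  have hm0 : 0 ≤ m := by positivity
  have k1 : |c * (α + η) - β * (t + k)| ≤ |α + η| + |B| * (t + k) := by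
    refine (abs_sub _ _).trans ?_
    rw [abs_mul, abs_mul, abs_of_pos (by linarith : 0 < t + k)]
    gcongr
    exact mul_le_of_le_one_left (abs_nonneg _) hc1
  have k2 : |c * α - β * t| ≤ |α| + |B| * t := by
    refine (abs_sub _ _).trans ?_
    rw [abs_mul, abs_mul, abs_of_pos ht]
    gcongr
    exact mul_le_of_le_one_left (abs_nonneg _) hc1
  have k3 : |β * (1 + s)| ≤ |B| * (1 + s) := by
    rw [abs_mul, abs_of_pos (by linarith : 0 < 1 + s)]; gcongr
  have tot : |(c * (α + η) - β * (t + k)) * qq s (t + k) (r * c)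
      - (c * α - β * t) * qq s t (r * c) + β * (1 + s) * QQ s t k (r * c)| ≤
      ((|α + η| + |B| * (t + k)) * C1 + (|α| + |B| * t) * C2 + |B| * (1 + s) * C3) * m := by
    refine (abs_add_le _ _).trans ((add_le_add (abs_sub _ _) le_rfl).trans ?_)
    rw [abs_mul, abs_mul, abs_mul (β * (1 + s)), add_mul, add_mul, mul_assoc _ C1, mul_assoc _ C2,
      mul_assoc _ C3]
    gcongr
    · exact b1 _
    · exact b2 _
    · exact b3 _
  calc _ ≤ |c|⁻¹ * (((|α + η| + |B| * (t + k)) * C1 + (|α| + |B| * t) * C2 + |B| * (1 + s) * C3) * m) := by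
        gcongr
    _ = ((|α + η| + |B| * (t + k)) * C1 + (|α| + |B| * t) * C2 + |B| * (1 + s) * C3) * (|c|⁻¹ * m) := by ring
    _ ≤ _ := by rw [mul_assoc _ (|c| ^ (s - 1))]; gcongr

section polar
variable {d : ℕ}

local notation "EE" => EuclideanSpace ℝ (Fin (d + 1))

lemma polar_int (F : EE → ℝ) :
    (Integrable (fun z : Metric.sphere (0 : EE) 1 × Set.Ioi (0:ℝ) => F (z.2.1 • z.1.1))
      ((volume : Measure EE).toSphere.prod (Measure.volumeIoiPow d)) ↔ Integrable F) ∧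
    ∫ z : Metric.sphere (0 : EE) 1 × Set.Ioi (0:ℝ), F (z.2.1 • z.1.1)
      ∂((volume : Measure EE).toSphere.prod (Measure.volumeIoiPow d)) = ∫ y, F y := by
  have mp := (volume : Measure EE).measurePreserving_homeomorphUnitSphereProd
  rw [show Module.finrank ℝ EE - 1 = d by simp] at mp
  have he : ∀ y : ({0}ᶜ : Set EE), F ((homeomorphUnitSphereProd EE y).2.1 •
      (homeomorphUnitSphereProd EE y).1.1) = F y.1 := by
    intro y
    congr 1
    have : ‖y.1‖ ≠ 0 := norm_ne_zero_iff.2 y.2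
    simp [smul_smul, this]
  constructor
  · rw [← mp.integrable_comp_emb (Homeomorph.measurableEmbedding _)]
    conv_rhs => rw [← restrict_compl_singleton (μ := (volume : Measure EE)) 0]
    rw [← IntegrableOn, integrableOn_iff_comap_subtypeVal (measurableSet_singleton _).compl]
    exact integrable_congr (Filter.Eventually.of_forall he)
  · rw [← mp.integral_comp (Homeomorph.measurableEmbedding _)]
    simp only [he]
    rw [integral_subtype_comap (measurableSet_singleton _).compl F, restrict_compl_singleton]

lemma pow_int_iff (f : ℝ → ℝ) :
    Integrable (fun r : Set.Ioi (0:ℝ) => f r.1) (Measure.volumeIoiPow d) ↔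
    IntegrableOn (fun r => r ^ d * f r) (Set.Ioi 0) := by
  rw [integrableOn_iff_comap_subtypeVal measurableSet_Ioi, Measure.volumeIoiPow,
    integrable_withDensity_iff_integrable_smul' (by fun_prop) (by simp)]
  refine integrable_congr (Filter.Eventually.of_forall ?_)
  rintro ⟨x, hx : 0 < x⟩
  simp (disch := positivity) [ENNReal.toReal_ofReal]

lemma pow_integral (f : ℝ → ℝ) :
    ∫ r : Set.Ioi (0:ℝ), f r.1 ∂(Measure.volumeIoiPow d) =
    ∫ r in Set.Ioi (0:ℝ), r ^ d * f r := by
  simp only [Measure.volumeIoiPow, ENNReal.ofReal]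
  rw [integral_withDensity_eq_integral_smul,
    integral_subtype_comap measurableSet_Ioi fun a ↦ Real.toNNReal (a ^ d) • f a,
    setIntegral_congr_fun measurableSet_Ioi fun x hx ↦ ?_]
  · rw [NNReal.smul_def, Real.coe_toNNReal _ (pow_nonneg hx.out.le _), smul_eq_mul]
  · exact (measurable_subtype_coe.pow_const _).real_toNNReal

lemma coord_le_norm (y : EE) (i : Fin (d + 1)) : |y i| ≤ ‖y‖ := by
  simpa using PiLp.norm_apply_le y i

lemma sphere_int {p : ℝ} (hp : -1 < p) :
    Integrable (fun θ : Metric.sphere (0 : EE) 1 => |θ.1 (Fin.last d)| ^ p)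
      (volume : Measure EE).toSphere := by
  -- integrability on the unit ball
  let f : Fin (d + 1) → ℝ → ℝ := fun i v =>
    if i = Fin.last d then (Set.Icc (-1:ℝ) 1).indicator (fun v => |v| ^ p) v
    else (Set.Icc (-1:ℝ) 1).indicator (fun _ => 1) v
  have hf : ∀ i, Integrable (f i) := by
    intro i
    by_cases hi : i = Fin.last d
    · simp only [f, hi, if_true]
      rw [integrable_indicator_iff measurableSet_Icc, integrableOn_Icc_iff_integrableOn_Ioc,
        ← intervalIntegrable_iff_integrableOn_Ioc_of_le (by norm_num)]
      have h1 : IntervalIntegrable (fun v : ℝ => |v| ^ p) volume 0 1 := by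
        refine (intervalIntegral.intervalIntegrable_rpow' (a := 0) (b := 1) hp).congr ?_
        intro v hv
        rw [Set.uIoc_of_le zero_le_one] at hv
        simp [abs_of_pos hv.1]
      have h2 : IntervalIntegrable (fun v : ℝ => |v| ^ p) volume (-1) 0 := by
        have := (h1.comp_sub_left 0)
        simp only [zero_sub, abs_neg, neg_zero] at this
        simpa using this.symm
      exact h2.trans h1
    · simp only [f, hi, if_false]
      rw [integrable_indicator_iff measurableSet_Icc]
      exact integrableOn_const (by simp)
  have hprod := Integrable.fintype_prod (μ := fun _ => volume) hf
  have hE : Integrable (fun y : EE => ∏ i, f i (y i)) :=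
    (PiLp.volume_preserving_ofLp (Fin (d + 1))).integrable_comp_of_integrable hprod
  have hball : Integrable (fun y : EE =>
      (Metric.ball (0 : EE) 1).indicator (fun y => |y (Fin.last d)| ^ p) y) := by
    refine hE.mono' ?_ (Filter.Eventually.of_forall fun y => ?_)
    · refine (Measurable.indicator ?_ measurableSet_ball).aestronglyMeasurable
      have : Measurable (fun y : EE => y (Fin.last d)) := by fun_prop
      exact (continuous_abs.measurable.comp this).pow_const _
    · by_cases hy : y ∈ Metric.ball (0 : EE) 1
      · have hy' : ‖y‖ < 1 := by simpa using hy
        have hm : ∀ i, y i ∈ Set.Icc (-1:ℝ) 1 := fun i =>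
          abs_le.1 ((coord_le_norm y i).trans hy'.le)
        rw [Set.indicator_of_mem hy, Real.norm_of_nonneg (by positivity)]
        have : ∀ i, f i (y i) = if i = Fin.last d then |y (Fin.last d)| ^ p else 1 := by
          intro i
          by_cases hi : i = Fin.last d
          · subst hi; simp only [f, if_true]; rw [Set.indicator_of_mem (hm _)]
          · simp only [f, hi, if_false]; rw [Set.indicator_of_mem (hm _)]
        simp [this]
      · rw [Set.indicator_of_notMem hy, norm_zero]
        refine Finset.prod_nonneg fun i _ => ?_
        simp only [f]
        split_ifs
        · exact Set.indicator_nonneg (fun _ _ => by positivity) _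
        · exact Set.indicator_nonneg (fun _ _ => by positivity) _
  have hS := ((polar_int _).1).2 hball
  have hae := hS.prod_left_ae
  have hpos : Measure.volumeIoiPow d (Set.Iio (⟨1, Set.mem_Ioi.2 one_pos⟩ : Set.Ioi (0:ℝ))) ≠ 0 := by
    rw [Measure.volumeIoiPow_apply_Iio]
    simp; positivity
  have hfr : ∃ᵐ r ∂(Measure.volumeIoiPow d), r ∈ Set.Iio (⟨1, Set.mem_Ioi.2 one_pos⟩ : Set.Ioi (0:ℝ)) :=
    frequently_ae_mem_iff.2 hpos
  obtain ⟨r, hr1, hr⟩ := (hfr.and_eventually hae).exists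
  have hr0 : 0 < r.1 := r.2
  have hr1' : r.1 < 1 := hr1
  have := hr.const_mul ((r.1 ^ p)⁻¹)
  refine this.congr (Filter.Eventually.of_forall fun θ => ?_)
  have hθ : ‖θ.1‖ = 1 := by simpa using θ.2
  have hmem : r.1 • θ.1 ∈ Metric.ball (0 : EE) 1 := by
    simp [norm_smul, hθ, abs_of_pos hr0, hr1']
  simp only [Set.indicator_of_mem hmem]
  rw [PiLp.smul_apply, smul_eq_mul, abs_mul, abs_of_pos hr0, Real.mul_rpow hr0.le (abs_nonneg _)]
  field_simp

end polar

lemma phiPlane_meas (d : ℕ) (s : ℝ) (a : EuclideanSpace ℝ (Fin (d + 1))) (b : ℝ) :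
    Measurable (phiPlane d s a b) := by
  have h1 : Measurable (fun x : EuclideanSpace ℝ (Fin (d + 1)) => x (Fin.last d)) := by fun_prop
  have h2 : Continuous (fun x : EuclideanSpace ℝ (Fin (d + 1)) => ⟪a, x⟫ + b) := by fun_prop
  exact ((ppw_meas s).comp h1).mul h2.measurable

lemma polar_eq (d : ℕ) (s : ℝ) (a : EuclideanSpace ℝ (Fin (d + 1))) (b : ℝ)
    (h x : EuclideanSpace ℝ (Fin (d + 1))) (μ : EuclideanSpace ℝ (Fin (d + 1)) → ℝ)
    (θ : EuclideanSpace ℝ (Fin (d + 1))) (hθ : ‖θ‖ = 1) (r : ℝ) (hr : 0 < r) :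
    (((phiPlane d s a b (x + r • θ + h) - phiPlane d s a b (x + r • θ)) +
              (phiPlane d s a b (x - r • θ + h) - phiPlane d s a b (x - r • θ))) / 2 -
            (phiPlane d s a b (x + h) - phiPlane d s a b x))
            * μ (‖r • θ‖⁻¹ • (r • θ)) / ‖r • θ‖ ^ ((d : ℝ) + 1 + 2 * s) =
    DD s (x (Fin.last d)) (h (Fin.last d)) (⟪a, x⟫ + b) ⟪a, h⟫ ⟪a, θ⟫ (θ (Fin.last d)) r
      * μ θ * r ^ (-((d : ℝ) + 1 + 2 * s)) := by
  have hn : ‖r • θ‖ = r := by rw [norm_smul, hθ, Real.norm_of_nonneg hr.le, mul_one]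
  rw [hn, smul_smul, inv_mul_cancel₀ hr.ne', one_smul, Real.rpow_neg hr.le, ← div_eq_mul_inv]
  congr 2
  simp only [phiPlane, DD, UU, ppw, PiLp.add_apply, PiLp.sub_apply, PiLp.smul_apply, smul_eq_mul,
    inner_add_right, inner_sub_right, inner_smul_right]
  have e1 : x (Fin.last d) + h (Fin.last d) + -r * θ (Fin.last d)
      = x (Fin.last d) - r * θ (Fin.last d) + h (Fin.last d) := by ring
  have e2 : x (Fin.last d) + h (Fin.last d) + r * θ (Fin.last d)
      = x (Fin.last d) + r * θ (Fin.last d) + h (Fin.last d) := by ring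
  have e3 : x (Fin.last d) + -r * θ (Fin.last d) = x (Fin.last d) - r * θ (Fin.last d) := by ring
  rw [e1, e2, e3]
  simp only [zero_mul, add_zero]
  ring

lemma rpow_comb (d : ℕ) (s r : ℝ) (hr : 0 < r) :
    r ^ d * r ^ (-((d : ℝ) + 1 + 2 * s)) = r ^ (-1 - 2 * s) := by
  rw [← Real.rpow_natCast, ← Real.rpow_add hr]
  congr 1; ring

lemma main_int (d : ℕ) (s lam Lam : ℝ) (hs0 : 0 < s) (hs1 : s < 1)
    (hlam : 0 < lam)
    (a : EuclideanSpace ℝ (Fin (d + 1))) (b : ℝ)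
    (h : EuclideanSpace ℝ (Fin (d + 1))) (hh : 0 ≤ h (Fin.last d))
    (x : EuclideanSpace ℝ (Fin (d + 1))) (hx : 0 < x (Fin.last d))
    (μ : EuclideanSpace ℝ (Fin (d + 1)) → ℝ) (hμ : SpecOK (d + 1) lam Lam μ)
    (F : EuclideanSpace ℝ (Fin (d + 1)) → ℝ)
    (hF : F = fun y : EuclideanSpace ℝ (Fin (d + 1)) =>
          (((phiPlane d s a b (x + y + h) - phiPlane d s a b (x + y)) +
              (phiPlane d s a b (x - y + h) - phiPlane d s a b (x - y))) / 2 -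
            (phiPlane d s a b (x + h) - phiPlane d s a b x))
            * μ (‖y‖⁻¹ • y) / ‖y‖ ^ ((d : ℝ) + 1 + 2 * s)) :
    Integrable F ∧ ∫ y, F y = 0 := by
  have hFm : Measurable F := by
    have h1 := phiPlane_meas d s a b
    have h2 := hμ.1
    rw [hF]
    fun_prop
  have hpol : ∀ (θ : Metric.sphere (0 : EuclideanSpace ℝ (Fin (d + 1))) 1) (r : Set.Ioi (0:ℝ)),
      F (r.1 • θ.1) = DD s (x (Fin.last d)) (h (Fin.last d)) (⟪a, x⟫ + b) ⟪a, h⟫ ⟪a, θ.1⟫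
        (θ.1 (Fin.last d)) r.1 * μ θ.1 * r.1 ^ (-((d : ℝ) + 1 + 2 * s)) := by
    intro θ r
    have hθ : ‖θ.1‖ = 1 := by simpa using θ.2
    rw [hF]
    exact polar_eq d s a b h x μ θ.1 hθ r.1 r.2
  obtain ⟨K, hK, hbd⟩ := DD_bd hs0 hs1 hx hh (⟪a, x⟫ + b) ⟪a, h⟫ ‖a‖
  have hI : Integrable (fun z : Metric.sphere (0 : EuclideanSpace ℝ (Fin (d + 1))) 1 ×
      Set.Ioi (0:ℝ) => F (z.2.1 • z.1.1))
      ((volume : Measure (EuclideanSpace ℝ (Fin (d + 1)))).toSphere.prod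
        (Measure.volumeIoiPow d)) := by
    have i1 := (sphere_int (d := d) (p := s - 1) (by linarith)).const_mul (Lam * K)
    have i2 : Integrable (fun r : Set.Ioi (0:ℝ) =>
        (fun r : ℝ => min (r ^ 2) (r ^ s) * r ^ (-((d : ℝ) + 1 + 2 * s))) r.1)
        (Measure.volumeIoiPow d) := by
      refine (pow_int_iff (d := d) (fun r : ℝ => min (r ^ 2) (r ^ s) * r ^ (-((d : ℝ) + 1 + 2 * s)))).2 ?_
      refine (mw_int hs0 hs1).congr_fun (fun r hr => ?_) measurableSet_Ioi
      simp only [mw]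
      rw [← rpow_comb d s r hr]
      ring
    refine (i1.mul_prod i2).mono' ?_ (Filter.Eventually.of_forall ?_)
    · refine (hFm.comp ?_).aestronglyMeasurable
      fun_prop
    · rintro ⟨θ, r⟩
      have hr : 0 < r.1 := r.2
      have hθ : ‖θ.1‖ = 1 := by simpa using θ.2
      simp only
      rw [hpol θ r, Real.norm_eq_abs, abs_mul, abs_mul,
        abs_of_nonneg (Real.rpow_nonneg hr.le _)]
      have hb := hbd ⟪a, θ.1⟫ (θ.1 (Fin.last d)) r.1
        (by simpa [hθ] using abs_real_inner_le_norm a θ.1)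
        (by simpa [hθ] using coord_le_norm θ.1 (Fin.last d)) hr
      obtain ⟨-, hm1, hm2⟩ := hμ.2 θ.1 hθ
      have hm : |μ θ.1| ≤ Lam := by rw [abs_of_nonneg (by linarith)]; exact hm2
      have hL : 0 ≤ Lam := by linarith
      calc _ ≤ (K * |θ.1 (Fin.last d)| ^ (s - 1) * min (r.1 ^ 2) (r.1 ^ s)) * Lam *
            r.1 ^ (-((d : ℝ) + 1 + 2 * s)) := by gcongr
        _ = _ := by ring
  refine ⟨(polar_int F).1.1 hI, ?_⟩
  rw [← (polar_int F).2, integral_prod _ hI]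
  refine integral_eq_zero_of_ae (Filter.Eventually.of_forall fun θ => ?_)
  have hθ : ‖θ.1‖ = 1 := by simpa using θ.2
  simp only [hpol, Pi.zero_apply]
  rw [pow_integral (d := d) (fun r => DD s (x (Fin.last d)) (h (Fin.last d)) (⟪a, x⟫ + b) ⟪a, h⟫
    ⟪a, θ.1⟫ (θ.1 (Fin.last d)) r * μ θ.1 * r ^ (-((d : ℝ) + 1 + 2 * s)))]
  have hz := DD_int hs0 hs1 hx hh (⟪a, x⟫ + b) ⟪a, h⟫ ⟪a, θ.1⟫ (θ.1 (Fin.last d))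
    (by simpa [hθ] using coord_le_norm θ.1 (Fin.last d))
  have hz' := congrArg (fun v => μ θ.1 * v) hz
  simp only [mul_zero] at hz'
  rw [← integral_const_mul] at hz'
  refine Eq.trans ?_ hz'
  refine setIntegral_congr_fun measurableSet_Ioi fun r hr => ?_
  simp only
  rw [← rpow_comb d s r hr]
  ring

/-- For `φ(x) = ((x_n)_+)^s (a·x + b)` and any `h` with `h_n ≥ 0`, every operator
`L ∈ L_*(s)` annihilates the increment `φ(·+h) - φ` on `{x_n > 0}` (with absolutely
convergent integral); in particular `M⁺{φ(·+h)-φ} = M⁻{φ(·+h)-φ} = 0` there. -/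
theorem stmt10 (d : ℕ) (s lam Lam : ℝ) (hs0 : 0 < s) (hs1 : s < 1)
    (hlam : 0 < lam) (hlL : lam ≤ Lam)
    (a : EuclideanSpace ℝ (Fin (d + 1))) (b : ℝ)
    (h : EuclideanSpace ℝ (Fin (d + 1))) (hh : 0 ≤ h (Fin.last d))
    (x : EuclideanSpace ℝ (Fin (d + 1))) (hx : 0 < x (Fin.last d)) :
    (∀ μ : EuclideanSpace ℝ (Fin (d + 1)) → ℝ, SpecOK (d + 1) lam Lam μ →
      Integrable (fun y : EuclideanSpace ℝ (Fin (d + 1)) =>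
          (((phiPlane d s a b (x + y + h) - phiPlane d s a b (x + y)) +
              (phiPlane d s a b (x - y + h) - phiPlane d s a b (x - y))) / 2 -
            (phiPlane d s a b (x + h) - phiPlane d s a b x))
            * μ (‖y‖⁻¹ • y) / ‖y‖ ^ ((d : ℝ) + 1 + 2 * s)) ∧
      kerOp (d + 1) s μ (fun z => phiPlane d s a b (z + h) - phiPlane d s a b z) x = 0) ∧
    Mplus (d + 1) s lam Lam (fun z => phiPlane d s a b (z + h) - phiPlane d s a b z) x = 0 ∧
    Mminus (d + 1) s lam Lam (fun z => phiPlane d s a b (z + h) - phiPlane d s a b z) x = 0 := by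
  have key : ∀ μ : EuclideanSpace ℝ (Fin (d + 1)) → ℝ, SpecOK (d + 1) lam Lam μ →
      kerOp (d + 1) s μ (fun z => phiPlane d s a b (z + h) - phiPlane d s a b z) x = 0 := by
    intro μ hμ
    have := (main_int d s lam Lam hs0 hs1 hlam a b h hh x hx μ hμ _ rfl).2
    unfold kerOp
    push_cast
    rw [this, mul_zero]
  have hset : {z : ℝ | ∃ μ, SpecOK (d + 1) lam Lam μ ∧
      z = kerOp (d + 1) s μ (fun z => phiPlane d s a b (z + h) - phiPlane d s a b z) x} = {0} := by
    ext z
    simp only [Set.mem_setOf_eq, Set.mem_singleton_iff]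
    constructor
    · rintro ⟨μ, hμ, rfl⟩
      exact key μ hμ
    · rintro rfl
      have hc : SpecOK (d + 1) lam Lam (fun _ => lam) :=
        ⟨measurable_const, fun _ _ => ⟨rfl, le_rfl, hlL⟩⟩
      exact ⟨_, hc, (key _ hc).symm⟩
  refine ⟨fun μ hμ => ⟨(main_int d s lam Lam hs0 hs1 hlam a b h hh x hx μ hμ _ rfl).1, key μ hμ⟩,
    ?_, ?_⟩
  · rw [Mplus, hset, csSup_singleton]
  · rw [Mminus, hset, csInf_singleton]
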